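/- Let K be an m × n complex matrix, α > 0, δ ≥ 0, and E ≥ 0. Suppose the true solution f_t ∈ ℂⁿ satisfies the source condition f_t = K† v for some v ∈ ℂᵐ with ‖v‖ ≤ E, let g = K f_t, and let g^δ ∈ ℂᵐ satisfy ‖g − g^δ‖ ≤ δ. Then the Tikhonov regularized solution f_α^δ = (K† K + α I)⁻¹ K† g^δ satisfies ‖f_α^δ − f_t‖ ≤ δ/(2√α) + (√α · E)/2. -/

import Mathlib

open Matrix

/-- The Euclidean norm of a complex vector, written out explicitly. -/
noncomputable def euclNorm {k : ℕ} (v : Fin k → ℂ) : ℝ :=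
  Real.sqrt (∑ i, ‖v i‖ ^ 2)

theorem euclNorm_eq {k : ℕ} (v : Fin k → ℂ) : euclNorm v = ‖WithLp.toLp 2 v‖ := by
  rw [EuclideanSpace.norm_eq]; rfl

theorem dot_self_eq {k : ℕ} (v : Fin k → ℂ) :
    star v ⬝ᵥ v = ((euclNorm v ^ 2 : ℝ) : ℂ) := by
  have h : (0 : ℝ) ≤ ∑ i, ‖v i‖ ^ 2 := Finset.sum_nonneg fun i _ => by positivity
  rw [euclNorm, Real.sq_sqrt h]
  simp only [dotProduct, Pi.star_apply, RCLike.star_def, Complex.conj_mul']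
  push_cast
  rfl

theorem dot_le {k : ℕ} (u w : Fin k → ℂ) :
    (star u ⬝ᵥ w).re ≤ euclNorm u * euclNorm w := by
  rw [euclNorm_eq, euclNorm_eq]
  have h := re_inner_le_norm (𝕜 := ℂ) (WithLp.toLp 2 u) (WithLp.toLp 2 w)
  rw [EuclideanSpace.inner_eq_star_dotProduct, dotProduct_comm] at h
  exact h

theorem key_bound {m n : ℕ} (K : Matrix (Fin m) (Fin n) ℂ) (α : ℝ) (hα : 0 < α)
    (e : Fin n → ℂ) (w : Fin m → ℂ)
    (h : (Kᴴ * K + (α : ℂ) • (1 : Matrix (Fin n) (Fin n) ℂ)) *ᵥ e = Kᴴ *ᵥ w) :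
    euclNorm e ≤ euclNorm w / (2 * Real.sqrt α) := by
  have h1 : star (K *ᵥ e) ⬝ᵥ (K *ᵥ e) + (α : ℂ) * (star e ⬝ᵥ e) = star (K *ᵥ e) ⬝ᵥ w := by
    have h2 := congrArg (fun x => star e ⬝ᵥ x) h
    simp only [add_mulVec, smul_mulVec, one_mulVec, dotProduct_add, dotProduct_smul,
      ← mulVec_mulVec, smul_eq_mul] at h2
    rw [dotProduct_mulVec (star e) Kᴴ w, dotProduct_mulVec (star e) Kᴴ (K *ᵥ e),
      ← star_mulVec] at h2
    exact h2
  rw [dot_self_eq, dot_self_eq] at h1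
  have h3 : euclNorm (K *ᵥ e) ^ 2 + α * euclNorm e ^ 2 ≤ euclNorm (K *ᵥ e) * euclNorm w := by
    refine le_trans (le_of_eq ?_) (dot_le (K *ᵥ e) w)
    rw [← h1, ← Complex.ofReal_mul, ← Complex.ofReal_add, Complex.ofReal_re]
  have hs : 0 < Real.sqrt α := Real.sqrt_pos.2 hα
  have hw : 0 ≤ euclNorm w := Real.sqrt_nonneg _
  rw [le_div_iff₀ (by positivity)]
  refine le_of_sq_le_sq ?_ hw
  have : (euclNorm e * (2 * Real.sqrt α)) ^ 2 = 4 * (α * euclNorm e ^ 2) := by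
    rw [mul_pow, mul_pow, Real.sq_sqrt hα.le]; ring
  rw [this]
  nlinarith [sq_nonneg (2 * euclNorm (K *ᵥ e) - euclNorm w)]

/-- **Error estimate for Tikhonov regularization under a source condition.**
If the true solution satisfies `f_t = K† v` with `‖v‖ ≤ E`, `g = K f_t`, and the
noisy data satisfies `‖g − g^δ‖ ≤ δ`, then the Tikhonov regularized solution
`f_α^δ = (K† K + α I)⁻¹ K† g^δ` satisfies
`‖f_α^δ − f_t‖ ≤ δ/(2√α) + (√α · E)/2`. -/
theorem tikhonov_error_bound
    (m n : ℕ) (K : Matrix (Fin m) (Fin n) ℂ)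
    (α δ E : ℝ) (hα : 0 < α) (hδ : 0 ≤ δ) (hE : 0 ≤ E)
    (ft : Fin n → ℂ) (v : Fin m → ℂ)
    (hsource : ft = Kᴴ.mulVec v) (hv : euclNorm v ≤ E)
    (gδ : Fin m → ℂ) (hnoise : euclNorm (K.mulVec ft - gδ) ≤ δ) :
    euclNorm ((Kᴴ * K + (α : ℂ) • (1 : Matrix (Fin n) (Fin n) ℂ))⁻¹.mulVec
        (Kᴴ.mulVec gδ) - ft) ≤
      δ / (2 * Real.sqrt α) + Real.sqrt α * E / 2 := by
  set A := Kᴴ * K + (α : ℂ) • (1 : Matrix (Fin n) (Fin n) ℂ) with hA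
  open scoped ComplexOrder in
  have hdet : IsUnit A.det := by
   have hpd : A.PosDef := by
     refine Matrix.PosDef.posSemidef_add (posSemidef_conjTranspose_mul_self K) ?_
     exact Matrix.PosDef.one.smul (by exact_mod_cast hα)
   exact (isUnit_iff_isUnit_det A).1 hpd.isUnit
  have hk := key_bound K α hα (A⁻¹ *ᵥ (Kᴴ *ᵥ gδ) - ft) (-(K *ᵥ ft - gδ) - (α : ℂ) • v) (by
    rw [← hA, mulVec_sub, mulVec_mulVec, mul_nonsing_inv A hdet, one_mulVec, hA, add_mulVec,
      smul_mulVec, one_mulVec, mulVec_sub, mulVec_neg, mulVec_sub, mulVec_smul, ← hsource,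
      mulVec_mulVec]
    abel)
  have hw : euclNorm (-(K *ᵥ ft - gδ) - (α : ℂ) • v) ≤ δ + α * E := by
    rw [euclNorm_eq] at hv hnoise ⊢
    rw [WithLp.toLp_sub, WithLp.toLp_neg, WithLp.toLp_smul]
    refine (norm_sub_le _ _).trans ?_
    rw [norm_neg, norm_smul, Complex.norm_real, Real.norm_of_nonneg hα.le]
    gcongr
  have hs : 0 < Real.sqrt α := Real.sqrt_pos.2 hα
  calc _ ≤ _ := hk
    _ ≤ (δ + α * E) / (2 * Real.sqrt α) := by gcongr
    _ = _ := by
      have := Real.sq_sqrt hα.le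
      field_simp
      rw [this]; ring
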